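/- For every ε > 0 and every g ∈ D(A*) one has ‖P_{ker(A* − iε)}(A* g + iε g) − P_{ker A*}(A* g)‖ ≤ ε·(‖g‖ + C·‖A* g‖), and likewise ‖P_{ker(A* + iε)}(A* g − iε g) − P_{ker A*}(A* g)‖ ≤ ε·(‖g‖ + C·‖A* g‖). -/

import Mathlib

open Complex Filter
open scoped ComplexInnerProductSpace

noncomputable section

variable {H : Type*} [NormedAddCommGroup H] [InnerProductSpace ℂ H] [CompleteSpace H]

/-- The eigenspace `ker (T - z·1)` of a partially defined linear operator `T`. -/
def pKer (T : H →ₗ.[ℂ] H) (z : ℂ) : Submodule ℂ H where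
  carrier := {u : H | ∃ hu : u ∈ T.domain, T ⟨u, hu⟩ = z • u}
  zero_mem' := ⟨T.domain.zero_mem, by
    have h0 : (⟨0, T.domain.zero_mem⟩ : T.domain) = 0 := rfl
    rw [h0, T.map_zero, smul_zero]⟩
  add_mem' := by
    rintro a b ⟨ha, hTa⟩ ⟨hb, hTb⟩
    refine ⟨T.domain.add_mem ha hb, ?_⟩
    have h : (⟨a + b, T.domain.add_mem ha hb⟩ : T.domain) = ⟨a, ha⟩ + ⟨b, hb⟩ := rfl
    rw [h, T.map_add, hTa, hTb, smul_add]
  smul_mem' := by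
    rintro c a ⟨ha, hTa⟩
    refine ⟨T.domain.smul_mem c ha, ?_⟩
    have h : (⟨c • a, T.domain.smul_mem c ha⟩ : T.domain) = c • (⟨a, ha⟩ : T.domain) := rfl
    rw [h, T.map_smul, hTa, smul_comm]

/-- Orthogonal projection onto a closed submodule, as a map `H →L[ℂ] H`. -/
def projCl (W : Submodule ℂ H) (hW : IsClosed (W : Set H)) : H →L[ℂ] H :=
  letI : CompleteSpace W := hW.completeSpace_coe
  W.subtypeL.comp (Submodule.orthogonalProjectionOnto W)

/-- The boundary map `Γ₁ε⁻ g = P_{ker(T - iε)} (T g + iε g)`. -/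
def Gamma1m (T : H →ₗ.[ℂ] H) (hker : ∀ z : ℂ, IsClosed ((pKer T z : Set H)))
    (ε : ℝ) (g : T.domain) : H :=
  projCl (pKer T ((ε : ℂ) * I)) (hker _) (T g + ((ε : ℂ) * I) • (g : H))

/-- The boundary map `Γ₁ε⁺ g = P_{ker(T + iε)} (T g - iε g)`. -/
def Gamma1p (T : H →ₗ.[ℂ] H) (hker : ∀ z : ℂ, IsClosed ((pKer T z : Set H)))
    (ε : ℝ) (g : T.domain) : H :=
  projCl (pKer T (-((ε : ℂ) * I))) (hker _) (T g - ((ε : ℂ) * I) • (g : H))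

/-- The map `Υε g = (2iε)⁻¹ (Γ₁ε⁻ g - Γ₁ε⁺ g)`. -/
def Ups (T : H →ₗ.[ℂ] H) (hker : ∀ z : ℂ, IsClosed ((pKer T z : Set H)))
    (ε : ℝ) (g : T.domain) : H :=
  (2 * (ε : ℂ) * I)⁻¹ • (Gamma1m T hker ε g - Gamma1p T hker ε g)

theorem norm_apply_le_norm_apply_add_smul (A : H →ₗ.[ℂ] H)
    (hsym : ∀ f g : A.domain, ⟪(f : H), (A g : H)⟫ = ⟪(A f : H), (g : H)⟫)
    {z : ℂ} (hz : z.re = 0) (f : A.domain) : ‖A f‖ ≤ ‖A f + z • (f : H)‖ := by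
  have him : (⟪A f, (f : H)⟫).im = 0 := by
    have h1 := congrArg Complex.im (inner_conj_symm (𝕜 := ℂ) (A f) (f : H))
    rw [hsym f f, conj_im] at h1
    linarith
  have hcross : RCLike.re ⟪A f, z • (f : H)⟫ = 0 := by
    rw [inner_smul_right]
    simp [hz, him]
  have hsq := norm_add_sq (𝕜 := ℂ) (A f) (z • (f : H))
  rw [hcross] at hsq
  exact le_of_sq_le_sq (by nlinarith [sq_nonneg ‖z • (f : H)‖]) (norm_nonneg _)

/-- The range of `T + z·1` for a partially defined linear operator `T`. -/
def shiftedRange (T : H →ₗ.[ℂ] H) (z : ℂ) : Submodule ℂ H :=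
  LinearMap.range (T.toFun + z • T.domain.subtype)

theorem mem_shiftedRange {T : H →ₗ.[ℂ] H} {z : ℂ} {v : H} :
    v ∈ shiftedRange T z ↔ ∃ f : T.domain, T f + z • (f : H) = v :=
  Iff.rfl

theorem isClosed_shiftedRange (A : H →ₗ.[ℂ] H) (hclosed : A.IsClosed)
    (hsym : ∀ f g : A.domain, ⟪(f : H), (A g : H)⟫ = ⟪(A f : H), (g : H)⟫)
    {C : ℝ} (hC : 0 < C) (hbound : ∀ f : A.domain, ‖(f : H)‖ ≤ C * ‖A f‖)
    {z : ℂ} (hz : z.re = 0) : IsClosed (shiftedRange A z : Set H) := by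
  have : CompleteSpace A.graph := IsClosed.completeSpace_coe (hs := hclosed)
  let φ : A.graph →L[ℂ] H :=
    (ContinuousLinearMap.snd ℂ H H + z • ContinuousLinearMap.fst ℂ H H).comp A.graph.subtypeL
  have hφ : AntilipschitzWith (max C 1).toNNReal φ := by
    refine AddMonoidHomClass.antilipschitz_of_bound φ fun p => ?_
    obtain ⟨⟨x, y⟩, hp⟩ := p
    obtain ⟨f, rfl, rfl⟩ := A.mem_graph_iff.1 hp
    have hA := norm_apply_le_norm_apply_add_smul A hsym hz f
    have hφp : φ ⟨((f : H), A f), hp⟩ = A f + z • (f : H) := rfl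
    rw [hφp, Real.coe_toNNReal _ (by positivity)]
    refine max_le ?_ ?_
    · calc ‖(f : H)‖ ≤ C * ‖A f‖ := hbound f
        _ ≤ max C 1 * ‖A f + z • (f : H)‖ := by gcongr; exact le_max_left _ _
    · calc ‖A f‖ = 1 * ‖A f‖ := (one_mul _).symm
        _ ≤ max C 1 * ‖A f + z • (f : H)‖ := by gcongr; exact le_max_right _ _
  have hrange : (shiftedRange A z : Set H) = Set.range φ := by
    ext v
    constructor
    · rintro ⟨f, rfl⟩
      exact ⟨⟨((f : H), A f), A.mem_graph f⟩, rfl⟩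
    · rintro ⟨⟨⟨x, y⟩, hp⟩, rfl⟩
      obtain ⟨f, rfl, rfl⟩ := A.mem_graph_iff.1 hp
      exact ⟨f, rfl⟩
  rw [hrange]
  exact hφ.isClosed_range φ.uniformContinuous

theorem pKer_adjoint_eq_orthogonal_shiftedRange (A : H →ₗ.[ℂ] H)
    (hdense : Dense (A.domain : Set H)) {z : ℂ} (hz : z.re = 0) :
    pKer A.adjoint z = (shiftedRange A z)ᗮ := by
  have hconj : (starRingEnd ℂ) z = -z := by
    apply Complex.ext <;> simp [hz]
  ext u
  rw [Submodule.mem_orthogonal']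
  constructor
  · rintro ⟨hu, hAu⟩ _ ⟨f, rfl⟩
    have h := LinearPMap.adjoint_isFormalAdjoint hdense ⟨u, hu⟩ f
    rw [hAu, inner_smul_left, hconj] at h
    change ⟪u, A f + z • (f : H)⟫ = 0
    rw [inner_add_right, inner_smul_right, ← h]
    ring
  · intro h
    have hw : ∀ f : A.domain, ⟪z • u, (f : H)⟫ = ⟪u, A f⟫ := fun f => by
      have h0 : ⟪u, A f + z • (f : H)⟫ = 0 := h _ ⟨f, rfl⟩
      rw [inner_add_right, inner_smul_right] at h0
      rw [inner_smul_left, hconj]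
      linear_combination -h0
    exact ⟨LinearPMap.mem_adjoint_domain_of_exists u ⟨_, hw⟩,
      LinearPMap.adjoint_apply_eq hdense _ hw⟩

theorem projCl_mem (W : Submodule ℂ H) (hW : IsClosed (W : Set H)) (v : H) : projCl W hW v ∈ W :=
  letI : CompleteSpace W := hW.completeSpace_coe
  (W.orthogonalProjectionOnto v).2

theorem sub_projCl_mem_orthogonal (W : Submodule ℂ H) (hW : IsClosed (W : Set H)) (v : H) :
    v - projCl W hW v ∈ Wᗮ :=
  letI : CompleteSpace W := hW.completeSpace_coe
  W.sub_starProjection_mem_orthogonal v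

theorem projCl_apply_of_mem_orthogonal (W : Submodule ℂ H) (hW : IsClosed (W : Set H)) {v : H}
    (hv : v ∈ Wᗮ) : projCl W hW v = 0 := by
  have h : projCl W hW v ∈ Wᗮ := by
    simpa using Wᗮ.sub_mem hv (sub_projCl_mem_orthogonal W hW v)
  exact inner_self_eq_zero.1 (h _ (projCl_mem W hW v))

theorem norm_projCl_sq_add_norm_sub_sq (W : Submodule ℂ H) (hW : IsClosed (W : Set H)) (v : H) :
    ‖v‖ ^ 2 = ‖projCl W hW v‖ ^ 2 + ‖v - projCl W hW v‖ ^ 2 := by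
  have h := norm_add_sq_eq_norm_sq_add_norm_sq_of_inner_eq_zero (projCl W hW v)
    (v - projCl W hW v) (sub_projCl_mem_orthogonal W hW v _ (projCl_mem W hW v))
  rw [add_sub_cancel] at h
  linear_combination h

theorem norm_projCl_le (W : Submodule ℂ H) (hW : IsClosed (W : Set H)) (v : H) :
    ‖projCl W hW v‖ ≤ ‖v‖ :=
  le_of_sq_le_sq (by
    linarith [norm_projCl_sq_add_norm_sub_sq W hW v, sq_nonneg ‖v - projCl W hW v‖])
    (norm_nonneg _)

theorem exists_sub_projCl_pKer_adjoint_eq (A : H →ₗ.[ℂ] H)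
    (hdense : Dense (A.domain : Set H)) (hclosed : A.IsClosed)
    (hsym : ∀ f g : A.domain, ⟪(f : H), (A g : H)⟫ = ⟪(A f : H), (g : H)⟫)
    {C : ℝ} (hC : 0 < C) (hbound : ∀ f : A.domain, ‖(f : H)‖ ≤ C * ‖A f‖)
    {z : ℂ} (hz : z.re = 0) (hker : IsClosed (pKer A.adjoint z : Set H)) (v : H) :
    ∃ f : A.domain, v - projCl (pKer A.adjoint z) hker v = A f + z • (f : H) := by
  have hR := isClosed_shiftedRange A hclosed hsym hC hbound hz
  have hmem := sub_projCl_mem_orthogonal _ hker v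
  have : CompleteSpace (shiftedRange A z) := hR.completeSpace_coe
  rw [Submodule.mem_orthogonal] at hmem
  have hmem' : v - projCl (pKer A.adjoint z) hker v ∈ (shiftedRange A z)ᗮᗮ := by
    rw [Submodule.mem_orthogonal, ← pKer_adjoint_eq_orthogonal_shiftedRange A hdense hz]
    exact hmem
  rw [Submodule.orthogonal_orthogonal] at hmem'
  obtain ⟨f, hf⟩ := mem_shiftedRange.1 hmem'
  exact ⟨f, hf.symm⟩

theorem projCl_pKer_adjoint_apply_add_smul (A : H →ₗ.[ℂ] H)
    (hdense : Dense (A.domain : Set H))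
    {z : ℂ} (hz : z.re = 0) (hker : IsClosed (pKer A.adjoint z : Set H)) (f : A.domain) :
    projCl (pKer A.adjoint z) hker (A f + z • (f : H)) = 0 := by
  refine projCl_apply_of_mem_orthogonal _ hker ?_
  rw [pKer_adjoint_eq_orthogonal_shiftedRange A hdense hz]
  exact Submodule.le_orthogonal_orthogonal _ ⟨f, rfl⟩

theorem norm_sub_projCl_pKer_adjoint_le (A : H →ₗ.[ℂ] H)
    (hdense : Dense (A.domain : Set H)) (hclosed : A.IsClosed)
    (hsym : ∀ f g : A.domain, ⟪(f : H), (A g : H)⟫ = ⟪(A f : H), (g : H)⟫)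
    {C : ℝ} (hC : 0 < C) (hbound : ∀ f : A.domain, ‖(f : H)‖ ≤ C * ‖A f‖)
    {z : ℂ} (hz : z.re = 0) (hker : IsClosed (pKer A.adjoint z : Set H))
    {u : H} (hu : u ∈ pKer A.adjoint 0) :
    ‖u - projCl (pKer A.adjoint z) hker u‖ ≤ ‖z‖ * (C * ‖u‖) := by
  obtain ⟨h, hh⟩ := exists_sub_projCl_pKer_adjoint_eq A hdense hclosed hsym hC hbound hz hker u
  set w := u - projCl (pKer A.adjoint z) hker u with hw
  have hnorm : ‖(h : H)‖ ≤ C * ‖w‖ := by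
    rw [hh]
    exact (hbound h).trans
      (mul_le_mul_of_nonneg_left (norm_apply_le_norm_apply_add_smul A hsym hz h) hC.le)
  have hAu : ⟪u, A h⟫ = 0 := by
    rw [pKer_adjoint_eq_orthogonal_shiftedRange A hdense Complex.zero_re,
      Submodule.mem_orthogonal'] at hu
    exact hu _ (mem_shiftedRange.2 ⟨h, by simp⟩)
  have hPw : ⟪projCl (pKer A.adjoint z) hker u, w⟫ = 0 :=
    sub_projCl_mem_orthogonal _ hker u _ (projCl_mem _ hker u)
  have hww : ⟪w, w⟫ = z * ⟪u, (h : H)⟫ := by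
    calc ⟪w, w⟫ = ⟪u, w⟫ := by
          conv_lhs => rw [hw, inner_sub_left, ← hw, hPw, sub_zero]
      _ = z * ⟪u, (h : H)⟫ := by
          rw [hh, inner_add_right, hAu, inner_smul_right, zero_add]
  have hsq : ‖w‖ * ‖w‖ ≤ ‖z‖ * (C * ‖u‖) * ‖w‖ := by
    calc ‖w‖ * ‖w‖ = ‖⟪w, w⟫‖ := by
          rw [inner_self_eq_norm_sq_to_K, norm_pow, sq]; simp
      _ = ‖z‖ * ‖⟪u, (h : H)⟫‖ := by rw [hww, norm_mul]
      _ ≤ ‖z‖ * (‖u‖ * (C * ‖w‖)) := by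
          gcongr
          exact (norm_inner_le_norm _ _).trans (by gcongr)
      _ = ‖z‖ * (C * ‖u‖) * ‖w‖ := by ring
  rcases (norm_nonneg w).eq_or_lt with h0 | h0
  · rw [← h0]; positivity
  · exact le_of_mul_le_mul_right hsq h0

theorem norm_projCl_pKer_adjoint_sub_le (A : H →ₗ.[ℂ] H)
    (hdense : Dense (A.domain : Set H)) (hclosed : A.IsClosed)
    (hsym : ∀ f g : A.domain, ⟪(f : H), (A g : H)⟫ = ⟪(A f : H), (g : H)⟫)
    {C : ℝ} (hC : 0 < C) (hbound : ∀ f : A.domain, ‖(f : H)‖ ≤ C * ‖A f‖)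
    (hker : ∀ z : ℂ, IsClosed (pKer A.adjoint z : Set H))
    {z : ℂ} (hz : z.re = 0) (v g : H) :
    ‖projCl (pKer A.adjoint z) (hker z) (v + z • g) - projCl (pKer A.adjoint 0) (hker 0) v‖
      ≤ ‖z‖ * (‖g‖ + C * ‖v‖) := by
  obtain ⟨f, hf⟩ := exists_sub_projCl_pKer_adjoint_eq A hdense hclosed hsym hC hbound
    Complex.zero_re (hker 0) v
  rw [zero_smul, add_zero] at hf
  have hpyth := norm_projCl_sq_add_norm_sub_sq _ (hker 0) v
  have hu := projCl_mem _ (hker 0) v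
  set u := projCl (pKer A.adjoint 0) (hker 0) v
  rw [hf] at hpyth
  set P := projCl (pKer A.adjoint z) (hker z)
  have hsplit : P (v + z • g) - u = z • P (g - f) + -(u - P u) := by
    have hv : v + z • g = u + (A f + z • (f : H)) + z • (g - f) := by
      rw [← hf, smul_sub]; abel
    rw [hv, map_add, map_add, projCl_pKer_adjoint_apply_add_smul A hdense hz, map_smul]
    abel
  have horth : ⟪z • P (g - f), -(u - P u)⟫ = 0 := by
    rw [inner_neg_right, neg_eq_zero]
    exact sub_projCl_mem_orthogonal _ (hker z) u _
      (Submodule.smul_mem _ _ (projCl_mem _ (hker z) _))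
  have hnorm := norm_add_sq_eq_norm_sq_add_norm_sq_of_inner_eq_zero _ _ horth
  rw [← hsplit, norm_neg, norm_smul] at hnorm
  have h1 : ‖P (g - f)‖ ≤ ‖g‖ + C * ‖A f‖ :=
    (norm_projCl_le _ (hker z) _).trans
      ((norm_sub_le _ _).trans (add_le_add_right (hbound f) _))
  have h2 : ‖u - P u‖ ≤ ‖z‖ * (C * ‖u‖) :=
    norm_sub_projCl_pKer_adjoint_le A hdense hclosed hsym hC hbound hz (hker z) hu
  have hAf : ‖A f‖ ≤ ‖v‖ := le_of_sq_le_sq (by nlinarith [sq_nonneg ‖u‖]) (norm_nonneg _)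
  refine le_of_sq_le_sq ?_ (by positivity)
  calc ‖P (v + z • g) - u‖ ^ 2
      = (‖z‖ * ‖P (g - f)‖) ^ 2 + ‖u - P u‖ ^ 2 := by rw [sq, hnorm]; ring
    _ ≤ (‖z‖ * (‖g‖ + C * ‖A f‖)) ^ 2 + (‖z‖ * (C * ‖u‖)) ^ 2 := by gcongr
    _ = ‖z‖ ^ 2 * (‖g‖ ^ 2 + 2 * ‖g‖ * (C * ‖A f‖) + C ^ 2 * ‖v‖ ^ 2) := by
        rw [hpyth]; ring
    _ ≤ ‖z‖ ^ 2 * (‖g‖ ^ 2 + 2 * ‖g‖ * (C * ‖v‖) + C ^ 2 * ‖v‖ ^ 2) := by gcongr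
    _ = (‖z‖ * (‖g‖ + C * ‖v‖)) ^ 2 := by ring

theorem statement_4
    (A : H →ₗ.[ℂ] H)
    (hdense : Dense (A.domain : Set H))
    (hclosed : A.IsClosed)
    (hsym : ∀ f g : A.domain, ⟪(f : H), (A g : H)⟫ = ⟪(A f : H), (g : H)⟫)
    (C : ℝ) (hC : 0 < C)
    (hbound : ∀ f : A.domain, ‖(f : H)‖ ≤ C * ‖A f‖)
    (hker : ∀ z : ℂ, IsClosed ((pKer A.adjoint z : Set H)))
    (ε : ℝ) (hε : 0 < ε) (g : A.adjoint.domain) :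
    ‖projCl (pKer A.adjoint ((ε : ℂ) * I)) (hker _) (A.adjoint g + ((ε : ℂ) * I) • (g : H))
        - projCl (pKer A.adjoint 0) (hker 0) (A.adjoint g)‖
      ≤ ε * (‖(g : H)‖ + C * ‖A.adjoint g‖) ∧
    ‖projCl (pKer A.adjoint (-((ε : ℂ) * I))) (hker _) (A.adjoint g - ((ε : ℂ) * I) • (g : H))
        - projCl (pKer A.adjoint 0) (hker 0) (A.adjoint g)‖
      ≤ ε * (‖(g : H)‖ + C * ‖A.adjoint g‖) := by
  have hnorm : ‖(ε : ℂ) * I‖ = ε := by simp [abs_of_pos hε]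
  have h1 := norm_projCl_pKer_adjoint_sub_le A hdense hclosed hsym hC hbound hker
    (z := (ε : ℂ) * I) (by simp) (A.adjoint g) g
  have h2 := norm_projCl_pKer_adjoint_sub_le A hdense hclosed hsym hC hbound hker
    (z := -((ε : ℂ) * I)) (by simp) (A.adjoint g) g
  rw [hnorm] at h1
  rw [norm_neg, hnorm, neg_smul, ← sub_eq_add_neg] at h2
  exact ⟨h1, h2⟩
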